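/- arXiv:1610.09211 — 2 statements merged into one kernel-verified Lean document; each statement's English description precedes it below -/
import Mathlib

section
/- Let $\widehat K = \{(x,y) : 0 < x < 1,\ 0 < y < 1-x\}$ be the reference triangle. There exists $C > 0$ such that for every $p \in \mathbb{N}$ and every continuous function $f$ on $\partial\widehat K$ that is a polynomial of degree at most $p$ on each edge, there is a polynomial $\mathcal{L}f$ of total degree at most $p$ on $\widehat K$ whose trace on $\partial\widehat K$ equals $f$ and which satisfies $\|\mathcal{L}f\|_{L^\infty(\widehat K)} + p^{-2}\|\nabla\mathcal{L}f\|_{L^\infty(\widehat K)} \le C\,\|f\|_{L^\infty(\partial\widehat K)}$. -/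
open Set

noncomputable section

/-- Evaluation of a bivariate polynomial at `(x, y)`. -/
def ev (P : MvPolynomial (Fin 2) ℝ) (x y : ℝ) : ℝ := MvPolynomial.eval ![x, y] P

lemma ev_add (P Q : MvPolynomial (Fin 2) ℝ) (x y : ℝ) : ev (P + Q) x y = ev P x y + ev Q x y := by
  simp [ev]

lemma ev_sub (P Q : MvPolynomial (Fin 2) ℝ) (x y : ℝ) : ev (P - Q) x y = ev P x y - ev Q x y := by
  simp [ev]

lemma ev_mul (P Q : MvPolynomial (Fin 2) ℝ) (x y : ℝ) : ev (P * Q) x y = ev P x y * ev Q x y := by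
  simp [ev]

lemma ev_pow (P : MvPolynomial (Fin 2) ℝ) (n : ℕ) (x y : ℝ) : ev (P ^ n) x y = ev P x y ^ n := by
  simp [ev]

lemma ev_C (c x y : ℝ) : ev (MvPolynomial.C c) x y = c := by simp [ev]

lemma ev_one (x y : ℝ) : ev 1 x y = 1 := by simp [ev]

lemma ev_X_zero (x y : ℝ) : ev (MvPolynomial.X 0) x y = x := by simp [ev]

lemma ev_X_one (x y : ℝ) : ev (MvPolynomial.X 1) x y = y := by simp [ev]

lemma ev_sum {ι : Type*} (s : Finset ι) (f : ι → MvPolynomial (Fin 2) ℝ) (x y : ℝ) :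
    ev (∑ i ∈ s, f i) x y = ∑ i ∈ s, ev (f i) x y := by
  simp [ev]

/-- The averages `(1 / b) ∫_a^{a+b} q` of a polynomial `q` depend polynomially on `a` and `b`, and
are values of `q` at intermediate points. -/
lemma exists_mvPolynomial_average (q : Polynomial ℝ) (a b : MvPolynomial (Fin 2) ℝ)
    (ha : a.totalDegree ≤ 1) (hb : b.totalDegree ≤ 1) :
    ∃ A : MvPolynomial (Fin 2) ℝ, A.totalDegree ≤ q.natDegree ∧
      ∀ x y, 0 ≤ ev b x y → ∃ ξ ∈ Set.Icc (ev a x y) (ev a x y + ev b x y),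
        ev A x y = q.eval ξ := by
  refine ⟨∑ n ∈ Finset.range (q.natDegree + 1), MvPolynomial.C (q.coeff n / (n + 1)) *
    ∑ i ∈ Finset.range (n + 1), (a + b) ^ i * a ^ (n - i), ?_, ?_⟩
  · refine MvPolynomial.totalDegree_finsetSum_le fun n hn => ?_
    refine (MvPolynomial.totalDegree_mul _ _).trans ?_
    rw [MvPolynomial.totalDegree_C, zero_add]
    refine MvPolynomial.totalDegree_finsetSum_le fun i hi => ?_
    refine (MvPolynomial.totalDegree_mul _ _).trans ?_
    have h1 := (MvPolynomial.totalDegree_pow (a + b) i).trans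
      (Nat.mul_le_mul_left i ((MvPolynomial.totalDegree_add a b).trans (max_le ha hb)))
    have h2 := (MvPolynomial.totalDegree_pow a (n - i)).trans (Nat.mul_le_mul_left _ ha)
    simp only [Finset.mem_range] at hn hi
    omega
  · intro x y hy
    simp only [ev_sum, ev_mul, ev_pow, ev_C, ev_add]
    generalize ev a x y = u at *
    generalize ev b x y = v at *
    rcases hy.eq_or_lt with rfl | hv
    · refine ⟨u, by simp, ?_⟩
      rw [Polynomial.eval_eq_sum_range]
      refine Finset.sum_congr rfl fun n _ => ?_
      have h : ∀ i ∈ Finset.range (n + 1), (u + 0) ^ i * u ^ (n - i) = u ^ n := by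
        intro i hi
        rw [add_zero, ← pow_add]
        congr 1
        simp only [Finset.mem_range] at hi
        omega
      rw [Finset.sum_congr rfl h]
      have : (n : ℝ) + 1 ≠ 0 := by positivity
      simp
      field_simp
    · have hderiv : ∀ t, HasDerivAt
          (fun t => ∑ n ∈ Finset.range (q.natDegree + 1), q.coeff n / (n + 1) * t ^ (n + 1))
          (q.eval t) t := by
        intro t
        rw [Polynomial.eval_eq_sum_range]
        refine HasDerivAt.fun_sum fun n _ => ?_
        have : (n : ℝ) + 1 ≠ 0 := by positivity
        refine ((hasDerivAt_pow (n + 1) t).const_mul (q.coeff n / ((n : ℝ) + 1))).congr_deriv ?_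
        rw [add_tsub_cancel_right]
        push_cast
        field_simp
      obtain ⟨ξ, hξ, h⟩ := exists_hasDerivAt_eq_slope _ (fun t => q.eval t)
        (show u < u + v by linarith) (fun t _ => (hderiv t).continuousAt.continuousWithinAt)
        (fun t _ => hderiv t)
      refine ⟨ξ, Ioo_subset_Icc_self hξ, ?_⟩
      rw [h, add_sub_cancel_left, eq_div_iff hv.ne', ← Finset.sum_sub_distrib, Finset.sum_mul]
      refine Finset.sum_congr rfl fun n _ => ?_
      have := geom_sum₂_mul (u + v) u (n + 1)
      simp only [add_tsub_cancel_right, add_sub_cancel_left] at this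
      rw [mul_assoc, this]
      ring

/-- A real polynomial vanishing at `0` and `1` is divisible by `X * (1 - X)`. -/
lemma exists_eq_X_mul_one_sub_X_mul (f : Polynomial ℝ) (h0 : f.eval 0 = 0) (h1 : f.eval 1 = 0) :
    ∃ q : Polynomial ℝ, f = Polynomial.X * (1 - Polynomial.X) * q := by
  obtain ⟨g, rfl⟩ := Polynomial.dvd_iff_isRoot.mpr h0
  have hg : g.IsRoot 1 := by simpa using h1
  obtain ⟨h, rfl⟩ := Polynomial.dvd_iff_isRoot.mpr hg
  refine ⟨-h, ?_⟩
  simp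
  ring

/-- Lifting of a datum on the edge `b = 0` that vanishes at the end points of that edge, with zero
values on the edges `a = 0` and `a + b = 1`. -/
lemma exists_edge_lifting (p : ℕ) (f : Polynomial ℝ) (hf : f.natDegree ≤ p)
    (h0 : f.eval 0 = 0) (h1 : f.eval 1 = 0) (M : ℝ)
    (hM : ∀ t ∈ Set.Icc (0 : ℝ) 1, |f.eval t| ≤ M) (a b : MvPolynomial (Fin 2) ℝ)
    (ha : a.totalDegree ≤ 1) (hb : b.totalDegree ≤ 1) :
    ∃ P : MvPolynomial (Fin 2) ℝ, P.totalDegree ≤ p ∧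
      (∀ x y, ev b x y = 0 → ev P x y = f.eval (ev a x y)) ∧
      (∀ x y, ev a x y = 0 → ev P x y = 0) ∧
      (∀ x y, ev a x y + ev b x y = 1 → ev P x y = 0) ∧
      (∀ x y, 0 ≤ ev a x y → 0 ≤ ev b x y → ev a x y + ev b x y ≤ 1 → |ev P x y| ≤ M) := by
  obtain ⟨q, hq⟩ := exists_eq_X_mul_one_sub_X_mul f h0 h1
  rcases eq_or_ne q 0 with rfl | hq0
  · have hf0 : f = 0 := by simpa using hq
    subst hf0
    have : 0 ≤ M := by simpa using hM 0 (by simp)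
    exact ⟨0, by simp, by simp [ev], by simp [ev], by simp [ev], by simp [ev, this]⟩
  obtain ⟨A, hAdeg, hA⟩ := exists_mvPolynomial_average q a b ha hb
  have hdeg : q.natDegree + 2 ≤ p := by
    have h2 : (Polynomial.X * (1 - Polynomial.X) : Polynomial ℝ).natDegree = 2 := by
      compute_degree!
    have hne : (Polynomial.X * (1 - Polynomial.X) : Polynomial ℝ) ≠ 0 := by
      intro h
      simp [h] at h2
    rw [hq, Polynomial.natDegree_mul hne hq0, h2] at hf
    omega
  refine ⟨a * (1 - (a + b)) * A, ?_, ?_, ?_, ?_, ?_⟩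
  · have h1 := MvPolynomial.totalDegree_mul (a * (1 - (a + b))) A
    have h2 := MvPolynomial.totalDegree_mul a (1 - (a + b))
    have h3 := MvPolynomial.totalDegree_sub 1 (a + b)
    have h4 := MvPolynomial.totalDegree_add a b
    rw [MvPolynomial.totalDegree_one] at h3
    omega
  · intro x y hy
    obtain ⟨ξ, hξ, h⟩ := hA x y hy.ge
    rw [hy, add_zero, Icc_self, mem_singleton_iff] at hξ
    subst hξ
    simp [ev_mul, ev_sub, ev_add, ev_one, h, hq, hy]
  · intro x y hy
    simp [ev_mul, hy]
  · intro x y hy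
    simp [ev_mul, ev_sub, ev_add, ev_one, hy]
  · intro x y hx hy hxy
    obtain ⟨ξ, ⟨hξ1, hξ2⟩, h⟩ := hA x y hy
    have hξM := hM ξ ⟨by linarith, by linarith⟩
    refine le_trans ?_ hξM
    simp only [ev_mul, ev_sub, ev_add, ev_one, h, hq, Polynomial.eval_mul, Polynomial.eval_sub,
      Polynomial.eval_X, Polynomial.eval_one, abs_mul]
    rw [abs_of_nonneg hx, abs_of_nonneg (show 0 ≤ ξ by linarith),
      abs_of_nonneg (show 0 ≤ 1 - (ev a x y + ev b x y) by linarith),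
      abs_of_nonneg (show 0 ≤ 1 - ξ by linarith)]
    gcongr
    · linarith

/-- The Markov inequality at the right end point of `[-1, 1]`. -/
lemma eval_derivative_one_le (n : ℕ) (S : Polynomial ℝ) (hdeg : S.natDegree ≤ n)
    (hS : ∀ t ∈ Set.Icc (-1 : ℝ) 1, |S.eval t| ≤ 1) : S.derivative.eval 1 ≤ (n : ℝ) ^ 2 := by
  have h := Polynomial.Chebyshev.eval_iterate_derivative_le_of_forall_abs_le_one (k := 1)
    le_rfl (Polynomial.natDegree_le_iff_degree_le.mp hdeg) hS
  simpa [Polynomial.Chebyshev.derivative_T_eval_one] using h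

/-- The Markov inequality at the left end point of `[0, L]`. -/
lemma abs_eval_derivative_zero_le (n : ℕ) (R : Polynomial ℝ) (hdeg : R.natDegree ≤ n) (L B : ℝ)
    (hL : 0 < L) (hR : ∀ t ∈ Set.Icc (0 : ℝ) L, |R.eval t| ≤ B) :
    |R.derivative.eval 0| ≤ 2 / L * (n : ℝ) ^ 2 * B := by
  have hB : 0 ≤ B := (abs_nonneg _).trans (hR 0 ⟨le_rfl, hL.le⟩)
  rcases hB.eq_or_lt with rfl | hB
  · have hR0 : R = 0 := by
      refine Polynomial.eq_zero_of_infinite_isRoot R ((Set.Icc_infinite hL).mono fun t ht => ?_)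
      simpa using hR t ht
    simp [hR0]
  have key : ∀ c : ℝ, |c| = B⁻¹ → c * R.derivative.eval 0 * (-(L / 2)) ≤ (n : ℝ) ^ 2 := by
    intro c hc
    have h := eval_derivative_one_le n
      (Polynomial.C c * R.comp (Polynomial.C (L / 2) * (1 - Polynomial.X))) ?_ ?_
    · convert h using 1
      simp [Polynomial.derivative_comp]
      ring
    · refine (Polynomial.natDegree_C_mul_le _ _).trans (Polynomial.natDegree_comp_le.trans ?_)
      have : (Polynomial.C (L / 2) * (1 - Polynomial.X) : Polynomial ℝ).natDegree ≤ 1 := by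
        compute_degree
      nlinarith
    · intro t ht
      simp only [Polynomial.eval_mul, Polynomial.eval_C, Polynomial.eval_comp, Polynomial.eval_sub,
        Polynomial.eval_one, Polynomial.eval_X, abs_mul, hc]
      rw [inv_mul_le_iff₀ hB, mul_one]
      exact hR _ ⟨by nlinarith [ht.2], by nlinarith [ht.1]⟩
  have h1 := key B⁻¹ (abs_of_pos (inv_pos.mpr hB))
  have h2 := key (-B⁻¹) (by rw [abs_neg, abs_of_pos (inv_pos.mpr hB)])
  have e : ∀ z : ℝ, B⁻¹ * z * (L / 2) ≤ (n : ℝ) ^ 2 → z ≤ 2 / L * (n : ℝ) ^ 2 * B := by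
    intro z hz
    calc z = 2 / L * (B⁻¹ * z * (L / 2)) * B := by field_simp
      _ ≤ _ := by gcongr
  exact abs_le'.mpr ⟨e _ (by linarith), e _ (by linarith)⟩

/-- The values of the restriction of a bivariate polynomial to a line. -/
lemma eval_aeval_line (P : MvPolynomial (Fin 2) ℝ) (x y d e t : ℝ) :
    (MvPolynomial.aeval ![Polynomial.C x + Polynomial.C d * Polynomial.X,
      Polynomial.C y + Polynomial.C e * Polynomial.X] P).eval t = ev P (x + d * t) (y + e * t) := by
  induction P using MvPolynomial.induction_on with
  | C a => simp [ev]
  | add P Q hP hQ => simp [ev_add, hP, hQ]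
  | mul_X P i hP => fin_cases i <;> simp [hP, ev]

/-- The chain rule for the restriction of a bivariate polynomial to a line. -/
lemma eval_derivative_aeval_line (P : MvPolynomial (Fin 2) ℝ) (x y d e : ℝ) :
    (MvPolynomial.aeval ![Polynomial.C x + Polynomial.C d * Polynomial.X,
      Polynomial.C y + Polynomial.C e * Polynomial.X] P).derivative.eval 0 =
    d * ev (MvPolynomial.pderiv 0 P) x y + e * ev (MvPolynomial.pderiv 1 P) x y := by
  set v : Fin 2 → Polynomial ℝ := ![Polynomial.C x + Polynomial.C d * Polynomial.X,
      Polynomial.C y + Polynomial.C e * Polynomial.X] with hv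
  have hev : ∀ Q, (MvPolynomial.aeval v Q).eval 0 = ev Q x y := by
    intro Q
    simpa [hv] using eval_aeval_line Q x y d e 0
  induction P using MvPolynomial.induction_on with
  | C a => simp [ev]
  | add P Q hP hQ =>
    simp only [map_add, Polynomial.eval_add, hP, hQ, ev_add]
    ring
  | mul_X P i hP =>
    fin_cases i <;>
    · simp [Polynomial.derivative_mul, hP, hev, ev_mul, ev_add, MvPolynomial.pderiv_X]
      simp [hv, ev]
      ring

/-- The Markov inequality for directional derivatives on the reference triangle. -/
lemma abs_directional_derivative_le (p : ℕ) (P : MvPolynomial (Fin 2) ℝ)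
    (hP : P.totalDegree ≤ p) (B : ℝ)
    (hB : ∀ x y : ℝ, 0 ≤ x → 0 ≤ y → x + y ≤ 1 → |ev P x y| ≤ B)
    (x y d e : ℝ) (hx : 0 ≤ x) (hy : 0 ≤ y) (hxy : x + y ≤ 1)
    (hx' : 0 ≤ x + d / 4) (hy' : 0 ≤ y + e / 4) (hxy' : x + d / 4 + (y + e / 4) ≤ 1) :
    |d * ev (MvPolynomial.pderiv 0 P) x y + e * ev (MvPolynomial.pderiv 1 P) x y| ≤
      8 * (p : ℝ) ^ 2 * B := by
  rw [← eval_derivative_aeval_line]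
  refine (abs_eval_derivative_zero_le p _ ?_ (1 / 4) B (by norm_num) ?_).trans_eq (by ring)
  · rw [← mul_one p]
    refine MvPolynomial.aeval_natDegree_le P hP _ fun i => ?_
    fin_cases i <;> simp <;> compute_degree
  · intro t ht
    rw [eval_aeval_line]
    obtain ⟨ht0, ht1⟩ := ht
    exact hB _ _ (by nlinarith) (by nlinarith) (by nlinarith)

/-- The Markov inequality for the gradient on the reference triangle. -/
lemma sqrt_gradient_le (p : ℕ) (P : MvPolynomial (Fin 2) ℝ)
    (hP : P.totalDegree ≤ p) (B : ℝ)
    (hB : ∀ x y : ℝ, 0 ≤ x → 0 ≤ y → x + y ≤ 1 → |ev P x y| ≤ B)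
    (x y : ℝ) (hx : 0 ≤ x) (hy : 0 ≤ y) (hxy : x + y ≤ 1) :
    Real.sqrt ((ev (MvPolynomial.pderiv (0 : Fin 2) P) x y) ^ 2 +
      (ev (MvPolynomial.pderiv (1 : Fin 2) P) x y) ^ 2) ≤ 32 * (p : ℝ) ^ 2 * B := by
  have key := fun d e => abs_directional_derivative_le p P hP B hB x y d e hx hy hxy
  set D₁ := ev (MvPolynomial.pderiv (0 : Fin 2) P) x y
  set D₂ := ev (MvPolynomial.pderiv (1 : Fin 2) P) x y
  set K := 8 * (p : ℝ) ^ 2 * B with hK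
  have h : |D₁| ≤ 2 * K ∧ |D₂| ≤ 2 * K := by
    have hdx : y ≤ 1 / 2 → |D₁| ≤ K := by
      intro hy2
      rcases le_total (1 / 4) x with h | h
      · simpa using key (-1) 0 (by linarith) (by linarith) (by linarith)
      · simpa using key 1 0 (by linarith) (by linarith) (by linarith)
    have hdy : x ≤ 1 / 2 → |D₂| ≤ K := by
      intro hx2
      rcases le_total (1 / 4) y with h | h
      · simpa using key 0 (-1) (by linarith) (by linarith) (by linarith)
      · simpa using key 0 1 (by linarith) (by linarith) (by linarith)
    rcases le_total x (1 / 2) with hx2 | hx2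
    · have h2 := abs_le.mp (hdy hx2)
      rcases le_total y (1 / 2) with hy2 | hy2
      · have h1 := abs_le.mp (hdx hy2)
        constructor <;> rw [abs_le] <;> constructor <;> linarith
      · have h1 := abs_le.mp (key 1 (-1) (by linarith) (by linarith) (by linarith))
        constructor <;> rw [abs_le] <;> constructor <;> linarith
    · have h1 := abs_le.mp (hdx (by linarith))
      have h2 := abs_le.mp (key (-1) 1 (by linarith) (by linarith) (by linarith))
      constructor <;> rw [abs_le] <;> constructor <;> linarith
  have h4 : Real.sqrt (D₁ ^ 2 + D₂ ^ 2) ≤ |D₁| + |D₂| := by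
    refine Real.sqrt_le_iff.mpr ⟨by positivity, ?_⟩
    nlinarith [sq_abs D₁, sq_abs D₂, mul_nonneg (abs_nonneg D₁) (abs_nonneg D₂)]
  linarith [h.1, h.2]

/-- Polynomial lifting from the boundary of the reference triangle
`K̂ = {(x,y) : 0 < x < 1, 0 < y < 1-x}`: there exists `C > 0` such that for every `p`
and every continuous edgewise-polynomial boundary datum of degree at most `p`
(given by polynomials `g₁, g₂, g₃` on the bottom edge, the left edge and the hypotenuse,
matching at the vertices) with `|f| ≤ M` on `∂K̂`, there is a bivariate polynomial `P`
of total degree at most `p` whose trace on `∂K̂` equals the datum and which satisfies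
`‖P‖_{L∞(K̂)} ≤ C M` and `p⁻²‖∇P‖_{L∞(K̂)} ≤ C M`. -/
theorem stmt3 :
    ∃ C : ℝ, 0 < C ∧
      ∀ (p : ℕ) (g₁ g₂ g₃ : Polynomial ℝ),
        g₁.natDegree ≤ p → g₂.natDegree ≤ p → g₃.natDegree ≤ p →
        -- continuity of the boundary datum at the three vertices
        g₁.eval 0 = g₂.eval 0 → g₁.eval 1 = g₃.eval 1 → g₂.eval 1 = g₃.eval 0 →
        ∀ M : ℝ,
        (∀ t ∈ Set.Icc (0 : ℝ) 1, |g₁.eval t| ≤ M ∧ |g₂.eval t| ≤ M ∧ |g₃.eval t| ≤ M) →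
        ∃ P : MvPolynomial (Fin 2) ℝ,
          MvPolynomial.totalDegree P ≤ p ∧
          -- the trace of P on ∂K̂ equals the boundary datum
          (∀ t ∈ Set.Icc (0 : ℝ) 1,
            ev P t 0 = g₁.eval t ∧ ev P 0 t = g₂.eval t ∧ ev P t (1 - t) = g₃.eval t) ∧
          -- L∞ bound and (scaled) gradient bound on K̂
          (∀ x y : ℝ, 0 ≤ x → 0 ≤ y → x + y ≤ 1 →
            |ev P x y| ≤ C * M ∧
            Real.sqrt ((ev (MvPolynomial.pderiv (0 : Fin 2) P) x y) ^ 2 +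
                (ev (MvPolynomial.pderiv (1 : Fin 2) P) x y) ^ 2) ≤
              C * (p : ℝ) ^ 2 * M) := by
  refine ⟨224, by norm_num, ?_⟩
  intro p g₁ g₂ g₃ hd₁ hd₂ hd₃ h12 h13 h23 M hM
  suffices h : ∃ P : MvPolynomial (Fin 2) ℝ, P.totalDegree ≤ p ∧
      (∀ t ∈ Set.Icc (0 : ℝ) 1,
        ev P t 0 = g₁.eval t ∧ ev P 0 t = g₂.eval t ∧ ev P t (1 - t) = g₃.eval t) ∧
      ∀ x y : ℝ, 0 ≤ x → 0 ≤ y → x + y ≤ 1 → |ev P x y| ≤ 7 * M by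
    obtain ⟨P, hP, htr, hb⟩ := h
    refine ⟨P, hP, htr, fun x y hx hy hxy => ⟨?_, ?_⟩⟩
    · have := hb x y hx hy hxy
      linarith [abs_nonneg (ev P x y)]
    · exact (sqrt_gradient_le p P hP _ hb x y hx hy hxy).trans_eq (by ring)
  obtain ⟨hM1a, -, -⟩ := hM 0 (by simp)
  obtain ⟨hM1b, hM1c, -⟩ := hM 1 (by simp)
  set a := g₁.eval 0 with ha
  set b := g₁.eval 1 with hb
  set c := g₂.eval 1 with hc
  have hconst : p = 0 → b - a = 0 ∧ c - a = 0 := by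
    rintro rfl
    rw [Polynomial.eq_C_of_natDegree_le_zero hd₁] at ha hb
    rw [Polynomial.eq_C_of_natDegree_le_zero hd₂] at h12 hc
    simp only [Polynomial.eval_C] at ha hb hc h12
    exact ⟨by linarith, by linarith⟩
  have hlin : ∀ u v t : ℝ, |u| ≤ M → |v| ≤ M → t ∈ Set.Icc (0 : ℝ) 1 →
      |u + (v - u) * t| ≤ M := by
    intro u v t hu hv ht
    rw [abs_le] at *
    obtain ⟨h0, h1⟩ := ht
    constructor <;> nlinarith
  have hres : ∀ (g : Polynomial ℝ) (u v : ℝ), g.natDegree ≤ p → (p = 0 → v - u = 0) →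
      g.eval 0 = u → g.eval 1 = v → (∀ t ∈ Set.Icc (0 : ℝ) 1, |g.eval t| ≤ M) →
      |u| ≤ M → |v| ≤ M → ∀ A B : MvPolynomial (Fin 2) ℝ, A.totalDegree ≤ 1 →
      B.totalDegree ≤ 1 → ∃ P : MvPolynomial (Fin 2) ℝ, P.totalDegree ≤ p ∧
      (∀ x y, ev B x y = 0 → ev P x y = g.eval (ev A x y) - (u + (v - u) * ev A x y)) ∧
      (∀ x y, ev A x y = 0 → ev P x y = 0) ∧
      (∀ x y, ev A x y + ev B x y = 1 → ev P x y = 0) ∧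
      (∀ x y, 0 ≤ ev A x y → 0 ≤ ev B x y → ev A x y + ev B x y ≤ 1 →
        |ev P x y| ≤ 2 * M) := by
    intro g u v hg hp hu hv hgM huM hvM A B hA hB
    have h := exists_edge_lifting p
      (g - (Polynomial.C u + Polynomial.C (v - u) * Polynomial.X)) ?_ (by simp [hu])
      (by simp [hv]) (2 * M) ?_ A B hA hB
    · simpa using h
    · refine Polynomial.natDegree_sub_le_of_le hg ?_ |>.trans (max_self p).le
      rcases Nat.eq_zero_or_pos p with h0 | h0
      · simp [hp h0]
      · refine le_trans ?_ h0
        compute_degree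
    · intro t ht
      have h1 := hlin u v t huM hvM ht
      have h2 := hgM t ht
      simp only [Polynomial.eval_sub, Polynomial.eval_add, Polynomial.eval_mul, Polynomial.eval_C,
        Polynomial.eval_X]
      linarith [abs_sub (g.eval t) (u + (v - u) * t)]
  have hX (i : Fin 2) : (MvPolynomial.X i : MvPolynomial (Fin 2) ℝ).totalDegree ≤ 1 := by simp
  have hZ : (1 - MvPolynomial.X 0 - MvPolynomial.X 1 : MvPolynomial (Fin 2) ℝ).totalDegree ≤ 1 := by
    refine (MvPolynomial.totalDegree_sub _ _).trans (max_le ?_ (hX 1))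
    exact (MvPolynomial.totalDegree_sub _ _).trans (max_le (by simp) (hX 0))
  obtain ⟨P₁, hP₁, h₁b, h₁0, h₁1, h₁M⟩ := hres g₁ a b hd₁ (fun h => (hconst h).1) rfl rfl
    (fun t ht => (hM t ht).1) hM1a hM1b (MvPolynomial.X 0) (MvPolynomial.X 1) (hX 0) (hX 1)
  obtain ⟨P₂, hP₂, h₂b, h₂0, h₂1, h₂M⟩ := hres g₂ a c hd₂ (fun h => (hconst h).2) h12.symm rfl
    (fun t ht => (hM t ht).2.1) hM1a hM1c (MvPolynomial.X 1) (MvPolynomial.X 0) (hX 1) (hX 0)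
  obtain ⟨P₃, hP₃, h₃b, h₃0, h₃1, h₃M⟩ := hres g₃ c b hd₃
    (fun h => by linarith [(hconst h).1, (hconst h).2]) h23.symm h13.symm
    (fun t ht => (hM t ht).2.2) hM1c hM1b (MvPolynomial.X 0)
    (1 - MvPolynomial.X 0 - MvPolynomial.X 1) (hX 0) hZ
  simp only [ev_sub, ev_one, ev_X_zero, ev_X_one] at h₁b h₁0 h₁1 h₁M h₂b h₂0 h₂1 h₂M h₃b h₃0 h₃1 h₃M
  have hdegX : ∀ (r : ℝ) (i : Fin 2), (p = 0 → r = 0) →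
      (MvPolynomial.C r * MvPolynomial.X i : MvPolynomial (Fin 2) ℝ).totalDegree ≤ p := by
    intro r i hr
    rcases Nat.eq_zero_or_pos p with h0 | h0
    · simp [hr h0]
    · refine (MvPolynomial.totalDegree_mul _ _).trans ?_
      simp only [MvPolynomial.totalDegree_C, MvPolynomial.totalDegree_X]
      omega
  refine ⟨MvPolynomial.C a + MvPolynomial.C (b - a) * MvPolynomial.X 0 +
    MvPolynomial.C (c - a) * MvPolynomial.X 1 + P₁ + P₂ + P₃, ?_, ?_, ?_⟩
  · have h1 := hdegX (b - a) 0 fun h => (hconst h).1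
    have h2 := hdegX (c - a) 1 fun h => (hconst h).2
    refine (MvPolynomial.totalDegree_add _ _).trans (max_le ?_ hP₃)
    refine (MvPolynomial.totalDegree_add _ _).trans (max_le ?_ hP₂)
    refine (MvPolynomial.totalDegree_add _ _).trans (max_le ?_ hP₁)
    refine (MvPolynomial.totalDegree_add _ _).trans (max_le ?_ h2)
    exact (MvPolynomial.totalDegree_add _ _).trans (max_le (by simp) h1)
  · intro t ht
    simp only [ev_add, ev_mul, ev_C, ev_X_zero, ev_X_one]
    refine ⟨?_, ?_, ?_⟩
    · rw [h₁b t 0 rfl, h₂0 t 0 rfl, h₃1 t 0 (by ring)]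
      ring
    · rw [h₁0 0 t rfl, h₂b 0 t rfl, h₃0 0 t rfl]
      ring
    · rw [h₁1 t (1 - t) (by ring), h₂1 t (1 - t) (by ring), h₃b t (1 - t) (by ring)]
      ring
  · intro x y hx hy hxy
    have e1 := abs_le.mp (h₁M x y hx hy hxy)
    have e2 := abs_le.mp (h₂M x y hy hx (by linarith))
    have e3 := abs_le.mp (h₃M x y hx (by linarith) (by linarith))
    have ea := abs_le.mp hM1a
    have eb := abs_le.mp hM1b
    have ec := abs_le.mp hM1c
    simp only [ev_add, ev_mul, ev_C, ev_X_zero, ev_X_one]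
    rw [abs_le]
    have hz : 0 ≤ 1 - x - y := by linarith
    constructor <;> nlinarith
end
end

section
/- Let $h_x, h_y \in (0,1]$ and $S_h = (0,h_x)\times(0,h_y)$. There exists $C>0$ independent of $p$, $h_x$, $h_y$ such that for every bivariate polynomial $\pi$ of degree at most $p$ in each variable: $\|\pi\|_{L^\infty(S_h)} \le C\,p\,(h_y/h_x)^{1/2}\,\|\partial_y \pi\|_{L^2(S_h)} + \|\pi(\cdot,0)\|_{L^\infty(0,h_x)}$. -/
open Set intervalIntegral

noncomputable section

theorem eval_one_derivative_le_of_abs_le {n : ℕ} {P : Polynomial ℝ} {M : ℝ}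
    (hP : P.natDegree ≤ n) (hM : ∀ u ∈ Set.Icc (-1 : ℝ) 1, |P.eval u| ≤ M) :
    |P.derivative.eval 1| ≤ (n : ℝ) ^ 2 * M := by
  have key : ∀ Q : Polynomial ℝ, Q.natDegree ≤ n → ∀ K : ℝ, 0 < K →
      (∀ u ∈ Set.Icc (-1 : ℝ) 1, |Q.eval u| ≤ K) →
      Q.derivative.eval 1 ≤ (n : ℝ) ^ 2 * K := by
    intro Q hQ K hK hQK
    have h := Polynomial.Chebyshev.eval_iterate_derivative_le_of_forall_abs_le_one
      (n := n) (P := Polynomial.C K⁻¹ * Q) (k := 1) (x := 1) le_rfl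
      (Polynomial.degree_le_of_natDegree_le ((Polynomial.natDegree_C_mul_le _ _).trans hQ))
      (fun u hu => by
        rw [Polynomial.eval_C_mul, abs_mul, abs_of_pos (inv_pos.2 hK), inv_mul_le_one₀ hK]
        exact hQK u hu)
    simp only [Function.iterate_one, Polynomial.derivative_C_mul, Polynomial.eval_C_mul,
      Polynomial.Chebyshev.derivative_T_eval_one, Int.cast_natCast] at h
    rwa [inv_mul_le_iff₀ hK, mul_comm] at h
  have hM0 : 0 ≤ M := (abs_nonneg _).trans (hM 0 (by norm_num))
  refine le_of_forall_pos_le_add fun ε hε => ?_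
  have hδ : 0 < ε / ((n : ℝ) ^ 2 + 1) := by positivity
  have hbd : ∀ u ∈ Set.Icc (-1 : ℝ) 1, |P.eval u| ≤ M + ε / ((n : ℝ) ^ 2 + 1) :=
    fun u hu => (hM u hu).trans (by linarith)
  have h1 := key P hP _ (by linarith) hbd
  have h2 := key (-P) (by simpa using hP) (M + ε / ((n : ℝ) ^ 2 + 1)) (by linarith)
    (by simpa using hbd)
  have h3 : (n : ℝ) ^ 2 * (M + ε / ((n : ℝ) ^ 2 + 1)) ≤ (n : ℝ) ^ 2 * M + ε := by
    have : (n : ℝ) ^ 2 * (ε / ((n : ℝ) ^ 2 + 1)) ≤ ε := by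
      rw [mul_div_assoc', div_le_iff₀ (by positivity)]
      nlinarith
    linarith
  simp only [Polynomial.derivative_neg, Polynomial.eval_neg] at h2
  exact (abs_le.2 ⟨by linarith, h1⟩).trans h3

theorem exists_derivative_eq (z : Polynomial ℝ) :
    ∃ F : Polynomial ℝ, F.derivative = z := by
  induction z using Polynomial.induction_on' with
  | add p q hp hq =>
    obtain ⟨F, rfl⟩ := hp
    obtain ⟨G, rfl⟩ := hq
    exact ⟨F + G, Polynomial.derivative_add⟩
  | monomial n a =>
    refine ⟨Polynomial.monomial (n + 1) (a / (n + 1)), ?_⟩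
    rw [Polynomial.derivative_monomial]
    congr 1
    push_cast
    field_simp

/-- Univariate `L¹`–`L∞` inverse estimate for nonnegative polynomials. -/
theorem eval_le_integral_of_nonneg {n : ℕ} {z : Polynomial ℝ} {h c : ℝ}
    (hz : z.natDegree ≤ n) (hz0 : ∀ s, 0 ≤ z.eval s) (hc : c ∈ Set.Icc 0 h) :
    h * z.eval c ≤ 4 * ((n : ℝ) + 1) ^ 2 * ∫ s in (0 : ℝ)..h, z.eval s := by
  obtain ⟨F, rfl⟩ := exists_derivative_eq z
  have hint : ∀ a b : ℝ, ∫ s in a..b, F.derivative.eval s = F.eval b - F.eval a := fun a b =>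
    intervalIntegral.integral_eq_sub_of_hasDerivAt (fun s _ => F.hasDerivAt s)
      (F.derivative.continuous.intervalIntegrable _ _)
  have hmono : Monotone fun s => F.eval s :=
    monotone_of_deriv_nonneg F.differentiable fun s => by simpa using hz0 s
  have hF : F.natDegree ≤ n + 1 := by
    rw [Polynomial.natDegree_derivative] at hz
    omega
  have key : ∀ w : ℝ, c + w ∈ Set.Icc 0 h →
      |w| * F.derivative.eval c ≤ 2 * ((n : ℝ) + 1) ^ 2 * (F.eval h - F.eval 0) := by
    intro w hw
    have hev : ∀ u, ((F - Polynomial.C (F.eval c)).comp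
        (Polynomial.C (c + w / 2) - Polynomial.C (w / 2) * Polynomial.X)).eval u =
        F.eval (c + w / 2 - w / 2 * u) - F.eval c := fun u => by simp
    have hM := eval_one_derivative_le_of_abs_le (n := n + 1) (M := F.eval h - F.eval 0)
      (P := (F - Polynomial.C (F.eval c)).comp
        (Polynomial.C (c + w / 2) - Polynomial.C (w / 2) * Polynomial.X)) ?_ ?_
    · have hd : ((F - Polynomial.C (F.eval c)).comp (Polynomial.C (c + w / 2) -
          Polynomial.C (w / 2) * Polynomial.X)).derivative.eval 1 =
          -(w / 2) * F.derivative.eval c := by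
        simp [Polynomial.derivative_comp]
      rw [hd, abs_mul, abs_neg, abs_div, abs_two, abs_of_nonneg (hz0 c)] at hM
      push_cast at hM
      linarith
    · rw [Polynomial.natDegree_comp, Polynomial.natDegree_sub_C]
      calc _ ≤ F.natDegree * 1 := by
            gcongr
            compute_degree
        _ ≤ n + 1 := by simpa using hF
    · intro u hu
      rw [hev]
      obtain ⟨hu1, hu2⟩ := hu
      obtain ⟨hw1, hw2⟩ := hw
      obtain ⟨hc1, hc2⟩ := hc
      have h0 : 0 ≤ c + w / 2 - w / 2 * u := by nlinarith
      have h1 : c + w / 2 - w / 2 * u ≤ h := by nlinarith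
      have e1 := hmono h0
      have e2 := hmono h1
      have e3 := hmono hc1
      have e4 := hmono hc2
      simp only at e1 e2 e3 e4
      exact abs_le.2 ⟨by linarith, by linarith⟩
  obtain ⟨hc1, hc2⟩ := hc
  have k1 := key (h - c) ⟨by linarith, by linarith⟩
  have k2 := key (-c) ⟨by linarith, by linarith⟩
  rw [abs_of_nonneg (by linarith)] at k1
  rw [abs_neg, abs_of_nonneg hc1] at k2
  rw [hint]
  linarith

/-- Univariate `L²`–`L∞` inverse estimate. -/
theorem sq_eval_le_integral_sq {p : ℕ} {q : Polynomial ℝ} {h c : ℝ} (hp : 1 ≤ p)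
    (hq : q.natDegree ≤ p) (hc : c ∈ Set.Icc 0 h) :
    h * q.eval c ^ 2 ≤ 36 * (p : ℝ) ^ 2 * ∫ s in (0 : ℝ)..h, q.eval s ^ 2 := by
  have hdeg : (q ^ 2).natDegree ≤ 2 * p := by
    rw [Polynomial.natDegree_pow]
    omega
  have H := eval_le_integral_of_nonneg hdeg (fun s => by simpa using sq_nonneg (q.eval s)) hc
  simp only [Polynomial.eval_pow] at H
  refine H.trans ?_
  have hI : 0 ≤ ∫ s in (0 : ℝ)..h, q.eval s ^ 2 :=
    intervalIntegral.integral_nonneg (hc.1.trans hc.2) fun s _ => sq_nonneg _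
  have hp' : (1 : ℝ) ≤ p := by exact_mod_cast hp
  refine mul_le_mul_of_nonneg_right ?_ hI
  push_cast
  nlinarith

theorem sq_integral_le_mul_integral_sq {f : ℝ → ℝ} (hf : Continuous f) {y : ℝ} (hy : 0 < y) :
    (∫ t in (0 : ℝ)..y, f t) ^ 2 ≤ y * ∫ t in (0 : ℝ)..y, f t ^ 2 := by
  set m := ∫ t in (0 : ℝ)..y, f t with hm
  have h0 : 0 ≤ ∫ t in (0 : ℝ)..y, (y * f t - m) ^ 2 :=
    intervalIntegral.integral_nonneg hy.le fun t _ => sq_nonneg _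
  have h1 : ∫ t in (0 : ℝ)..y, (y * f t - m) ^ 2 =
      y ^ 2 * (∫ t in (0 : ℝ)..y, f t ^ 2) - 2 * y * m * m + y * m ^ 2 := by
    have : ∀ t, (y * f t - m) ^ 2 = y ^ 2 * f t ^ 2 - 2 * y * m * f t + m ^ 2 := fun t => by ring
    simp_rw [this]
    rw [intervalIntegral.integral_add, intervalIntegral.integral_sub,
      intervalIntegral.integral_const_mul, intervalIntegral.integral_const_mul,
      intervalIntegral.integral_const, ← hm]
    · simp
    all_goals exact Continuous.intervalIntegrable (by fun_prop) _ _
  rw [h1] at h0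
  have h2 : 0 ≤ y * (y * (∫ t in (0 : ℝ)..y, f t ^ 2) - m ^ 2) := by linarith
  linarith [nonneg_of_mul_nonneg_right h2 hy]

theorem continuous_ev (P : MvPolynomial (Fin 2) ℝ) : Continuous fun z : ℝ × ℝ => ev P z.1 z.2 := by
  unfold ev
  refine (MvPolynomial.continuous_eval P).comp (continuous_pi fun i => ?_)
  fin_cases i
  · exact continuous_fst
  · exact continuous_snd

theorem continuous_ev_right (P : MvPolynomial (Fin 2) ℝ) (x : ℝ) : Continuous fun t => ev P x t := by
  unfold ev
  refine (MvPolynomial.continuous_eval P).comp (continuous_pi fun i => ?_)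
  fin_cases i
  · exact continuous_const
  · exact continuous_id

theorem hasDerivAt_ev (P : MvPolynomial (Fin 2) ℝ) (x y : ℝ) :
    HasDerivAt (fun t => ev P x t) (ev (MvPolynomial.pderiv (1 : Fin 2) P) x y) y := by
  unfold ev
  induction P using MvPolynomial.induction_on with
  | C a => simpa using hasDerivAt_const y a
  | add p q hp hq =>
    simp only [map_add]
    exact hp.add hq
  | mul_X p i hp =>
    have hX : HasDerivAt (fun t => MvPolynomial.eval ![x, t] (MvPolynomial.X i))
        (MvPolynomial.eval ![x, y] (MvPolynomial.pderiv (1 : Fin 2) (MvPolynomial.X i))) y := by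
      fin_cases i
      · simpa using hasDerivAt_const y x
      · simpa using hasDerivAt_id' y
    have h := hp.mul hX
    simp only [MvPolynomial.pderiv_mul, map_add, map_mul]
    exact h

theorem degreeOf_pderiv_le {σ : Type*} (i j : σ) (P : MvPolynomial σ ℝ) :
    MvPolynomial.degreeOf i (MvPolynomial.pderiv j P) ≤ MvPolynomial.degreeOf i P := by
  rw [MvPolynomial.degreeOf_le_iff]
  intro m hm
  rw [MvPolynomial.mem_support_iff, MvPolynomial.coeff_pderiv] at hm
  have h := MvPolynomial.monomial_le_degreeOf i
    (MvPolynomial.mem_support_iff.2 (left_ne_zero_of_mul hm))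
  exact (by simp : m i ≤ _).trans h

theorem exists_polynomial_eval_eq_ev (P : MvPolynomial (Fin 2) ℝ) (t : ℝ) :
    ∃ q : Polynomial ℝ, q.natDegree ≤ MvPolynomial.degreeOf 0 P ∧ ∀ s, q.eval s = ev P s t := by
  refine ⟨(MvPolynomial.finSuccEquiv ℝ 1 P).map (MvPolynomial.eval ![t]), ?_, fun s => ?_⟩
  · rw [← MvPolynomial.natDegree_finSuccEquiv]
    exact Polynomial.natDegree_map_le
  · exact (MvPolynomial.eval_eq_eval_mv_eval' ![t] s P).symm

theorem pderiv_eq_zero_of_degreeOf_eq_zero {σ : Type*} {i : σ} {P : MvPolynomial σ ℝ}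
    (h : MvPolynomial.degreeOf i P = 0) : MvPolynomial.pderiv i P = 0 := by
  classical
  refine MvPolynomial.pderiv_eq_zero_of_notMem_vars fun hi => ?_
  rw [MvPolynomial.vars_def, Multiset.mem_toFinset, ← Multiset.count_pos,
    ← MvPolynomial.degreeOf_def] at hi
  omega

/-- The inverse estimate in `x`, integrated in `y`: the `L²` norm on a vertical line is controlled by
the `L²` norm on the rectangle. -/
theorem integral_sq_ev_le {p : ℕ} {P : MvPolynomial (Fin 2) ℝ} {hx hy x : ℝ} (hp : 1 ≤ p)
    (hP : MvPolynomial.degreeOf 0 P ≤ p) (hy0 : 0 ≤ hy) (hxm : x ∈ Set.Icc 0 hx) :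
    hx * ∫ t in (0 : ℝ)..hy, ev P x t ^ 2 ≤
      36 * (p : ℝ) ^ 2 * ∫ s in (0 : ℝ)..hx, ∫ t in (0 : ℝ)..hy, ev P s t ^ 2 := by
  have hcont := continuous_ev P
  have hcont2 : Continuous (Function.uncurry fun s t => ev P s t ^ 2) := hcont.pow 2
  have hcont3 : Continuous fun t => ∫ s in (0 : ℝ)..hx, ev P s t ^ 2 := by
    have hswap : Continuous (Function.uncurry fun t s => ev P s t ^ 2) :=
      (hcont.comp continuous_swap).pow 2
    exact intervalIntegral.continuous_parametric_intervalIntegral_of_continuous' hswap 0 hx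
  rw [MeasureTheory.intervalIntegral_intervalIntegral_swap,
    ← intervalIntegral.integral_const_mul, ← intervalIntegral.integral_const_mul]
  · refine intervalIntegral.integral_mono_on hy0 ?_ ?_ fun t _ => ?_
    · refine Continuous.intervalIntegrable ?_ _ _
      exact continuous_const.mul ((continuous_ev_right P x).pow 2)
    · refine Continuous.intervalIntegrable ?_ _ _
      exact continuous_const.mul hcont3
    · obtain ⟨q, hq, hqe⟩ := exists_polynomial_eval_eq_ev P t
      simpa only [hqe] using sq_eval_le_integral_sq hp (hq.trans hP) hxm
  · exact (hcont2.continuousOn.integrableOn_compact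
      (isCompact_uIcc.prod isCompact_uIcc)).mono_set
        (Set.prod_mono Set.uIoc_subset_uIcc Set.uIoc_subset_uIcc)

theorem integral_pderiv_eq_sub (P : MvPolynomial (Fin 2) ℝ) (x y : ℝ) :
    ∫ t in (0 : ℝ)..y, ev (MvPolynomial.pderiv (1 : Fin 2) P) x t = ev P x y - ev P x 0 :=
  intervalIntegral.integral_eq_sub_of_hasDerivAt (fun t _ => hasDerivAt_ev P x t)
    ((continuous_ev_right _ x).intervalIntegrable _ _)

theorem sq_integral_ev_le {p : ℕ} {P : MvPolynomial (Fin 2) ℝ} {hx hy x y : ℝ} (hp : 1 ≤ p)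
    (hP : MvPolynomial.degreeOf 0 P ≤ p) (hxm : x ∈ Set.Ioo 0 hx) (hym : y ∈ Set.Ioo 0 hy) :
    (∫ t in (0 : ℝ)..y, ev P x t) ^ 2 ≤
      (6 * (p : ℝ)) ^ 2 * (hy / hx * ∫ s in (0 : ℝ)..hx, ∫ t in (0 : ℝ)..hy, ev P s t ^ 2) := by
  have hx0 : 0 < hx := hxm.1.trans hxm.2
  have hy0 : 0 < hy := hym.1.trans hym.2
  have hcont := continuous_ev_right P x
  have hline := integral_sq_ev_le hp hP hy0.le (Set.Ioo_subset_Icc_self hxm)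
  have hmono : ∫ t in (0 : ℝ)..y, ev P x t ^ 2 ≤ ∫ t in (0 : ℝ)..hy, ev P x t ^ 2 :=
    intervalIntegral.integral_mono_interval le_rfl hym.1.le hym.2.le
      (Filter.Eventually.of_forall fun t => sq_nonneg (ev P x t))
      ((hcont.pow 2).intervalIntegrable 0 hy)
  have hnn : 0 ≤ ∫ t in (0 : ℝ)..y, ev P x t ^ 2 :=
    intervalIntegral.integral_nonneg hym.1.le fun t _ => sq_nonneg _
  have hCS := sq_integral_le_mul_integral_sq hcont hym.1
  generalize (∫ s in (0 : ℝ)..hx, ∫ t in (0 : ℝ)..hy, ev P s t ^ 2) = I at hline ⊢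
  calc _ ≤ _ := hCS
    _ ≤ hy * ∫ t in (0 : ℝ)..hy, ev P x t ^ 2 := mul_le_mul hym.2.le hmono hnn hy0.le
    _ ≤ hy * (36 * (p : ℝ) ^ 2 * I / hx) :=
        mul_le_mul_of_nonneg_left ((le_div_iff₀' hx0).2 hline) hy0.le
    _ = _ := by ring

theorem abs_ev_sub_ev_zero_le {p : ℕ} {P : MvPolynomial (Fin 2) ℝ} {hx hy x y : ℝ}
    (h0 : MvPolynomial.degreeOf 0 P ≤ p) (h1 : MvPolynomial.degreeOf 1 P ≤ p)
    (hxm : x ∈ Set.Ioo 0 hx) (hym : y ∈ Set.Ioo 0 hy) :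
    |ev P x y - ev P x 0| ≤ 6 * (p : ℝ) * Real.sqrt (hy / hx) *
      Real.sqrt (∫ s in (0 : ℝ)..hx, ∫ t in (0 : ℝ)..hy,
        (ev (MvPolynomial.pderiv (1 : Fin 2) P) s t) ^ 2) := by
  have hx0 : 0 < hx := hxm.1.trans hxm.2
  have hy0 : 0 < hy := hym.1.trans hym.2
  rw [← integral_pderiv_eq_sub]
  rcases Nat.eq_zero_or_pos p with rfl | hp
  · simp [pderiv_eq_zero_of_degreeOf_eq_zero (Nat.le_zero.1 h1), ev]
  · rw [mul_assoc, ← Real.sqrt_mul (div_nonneg hy0.le hx0.le)]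
    have hsq := sq_integral_ev_le hp ((degreeOf_pderiv_le 0 1 P).trans h0) hxm hym
    refine (Real.abs_le_sqrt hsq).trans_eq ?_
    rw [Real.sqrt_mul (sq_nonneg _), Real.sqrt_sq (by positivity)]

/-- Anisotropic polynomial inverse estimate on the rectangle `S_h = (0,h_x)×(0,h_y)`:
there is `C > 0` independent of `p, h_x, h_y` such that for every bivariate polynomial
`π` of degree at most `p` in each variable,
`‖π‖_{L∞(S_h)} ≤ C p (h_y/h_x)^{1/2} ‖∂_y π‖_{L²(S_h)} + ‖π(·,0)‖_{L∞(0,h_x)}`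
(sup norms expressed pointwise resp. via a bound `M`). -/
theorem stmt6 :
    ∃ C : ℝ, 0 < C ∧
      ∀ (p : ℕ) (hx hy : ℝ), hx ∈ Set.Ioc (0 : ℝ) 1 → hy ∈ Set.Ioc (0 : ℝ) 1 →
      ∀ π : MvPolynomial (Fin 2) ℝ,
        MvPolynomial.degreeOf 0 π ≤ p → MvPolynomial.degreeOf 1 π ≤ p →
      ∀ M : ℝ, (∀ x ∈ Set.Ioo (0 : ℝ) hx, |ev π x 0| ≤ M) →
      ∀ x ∈ Set.Ioo (0 : ℝ) hx, ∀ y ∈ Set.Ioo (0 : ℝ) hy,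
        |ev π x y| ≤
          C * (p : ℝ) * Real.sqrt (hy / hx) *
              Real.sqrt (∫ s in (0 : ℝ)..hx, ∫ t in (0 : ℝ)..hy,
                (ev (MvPolynomial.pderiv (1 : Fin 2) π) s t) ^ 2) + M := by
  refine ⟨6, by norm_num, fun p hx hy _ _ π h0 h1 M hM x hxm y hym => ?_⟩
  calc |ev π x y| = |(ev π x y - ev π x 0) + ev π x 0| := by rw [sub_add_cancel]
    _ ≤ |ev π x y - ev π x 0| + |ev π x 0| := abs_add_le _ _
    _ ≤ _ := add_le_add (abs_ev_sub_ev_zero_le h0 h1 hxm hym) (hM x hxm)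
end
end
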